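/- arXiv:1810.06771 — 4 statements merged into one kernel-verified Lean document; each statement's English description precedes it below -/
import Mathlib

section
/- Let X be an ordered metric space, i.e. a metric space equipped with a partial order ≤ such that the set {(x,y) ∈ X × X : x ≤ y} is closed in X × X. Define the stochastic order on the Radon probability measures on X by: p ⪯ q if and only if there exists a probability measure r on X × X whose first marginal is p, whose second marginal is q, and which is supported on the set {(x,y) : x ≤ y}. Then the stochastic order is antisymmetric: if p ⪯ q and q ⪯ p, then p = q. -/
open MeasureTheory

/-- In a space with closed order, the upper closure of a compact set is closed. -/
theorem IsCompact.isClosed_setOf_exists_le {X : Type*} [TopologicalSpace X] [Preorder X]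
    [OrderClosedTopology X] {K : Set X} (hK : IsCompact K) :
    IsClosed {y : X | ∃ x ∈ K, x ≤ y} := by
  have : CompactSpace K := isCompact_iff_compactSpace.mp hK
  have hcl : IsClosed {z : K × X | (z.1 : X) ≤ z.2} :=
    isClosed_le (continuous_subtype_val.comp continuous_fst) continuous_snd
  convert isClosedMap_snd_of_compactSpace _ hcl using 1
  ext y
  simp

/-- A coupling supported on the order relation, whose first marginal gives an upper set at least
the mass that the second one does, almost surely does not jump into that upper set. -/
theorem measure_notMem_inter_mem_eq_zero {X : Type*} [Preorder X] [MeasurableSpace X]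
    {r : Measure (X × X)} [IsFiniteMeasure r] (hr : ∀ᵐ z ∂r, z.1 ≤ z.2)
    {U : Set X} (hU : IsUpperSet U) (hm : MeasurableSet U)
    (hle : r (Prod.snd ⁻¹' U) ≤ r (Prod.fst ⁻¹' U)) :
    r (Prod.snd ⁻¹' U \ Prod.fst ⁻¹' U) = 0 := by
  have hsub : (Prod.fst ⁻¹' U : Set (X × X)) ≤ᵐ[r] Prod.snd ⁻¹' U := by
    filter_upwards [hr] with z hz hzU using hU hz hzU
  exact ae_le_set.mp (ae_eq_of_ae_subset_of_measure_ge hsub hle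
    (measurable_fst hm).nullMeasurableSet (measure_ne_top _ _)).symm.le

/-- In a metric space with closed order, countably many closed upper sets suffice to witness the
failure of `y ≤ x` for all `y` in a given compact set. -/
theorem IsCompact.exists_countable_isClosed_isUpperSet {X : Type*} [MetricSpace X] [Preorder X]
    [OrderClosedTopology X] {C : Set X} (hC : IsCompact C) :
    ∃ S : Set (Set X), S.Countable ∧ (∀ U ∈ S, IsClosed U ∧ IsUpperSet U) ∧
      ∀ x, ∀ y ∈ C, ¬ y ≤ x → ∃ U ∈ S, y ∈ U ∧ x ∉ U := by
  obtain ⟨c, hc, hCc⟩ := hC.isSeparable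
  let U : X × ℕ → Set X := fun i =>
    {y | ∃ k ∈ Metric.closedBall i.1 (1 / ((i.2 : ℝ) + 1)) ∩ C, k ≤ y}
  refine ⟨U '' (c ×ˢ Set.univ), (hc.prod Set.countable_univ).image U, ?_, ?_⟩
  · rintro _ ⟨i, -, rfl⟩
    exact ⟨(hC.inter_left Metric.isClosed_closedBall).isClosed_setOf_exists_le,
      fun a b hab ⟨k, hk, hka⟩ => ⟨k, hk, hka.trans hab⟩⟩
  · intro x y hy hyx
    obtain ⟨ε, hε, hball⟩ := Metric.isOpen_iff.mp (isClosed_Iic (a := x)).isOpen_compl y hyx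
    obtain ⟨n, hn⟩ := exists_nat_one_div_lt (half_pos hε)
    obtain ⟨a, ha, hya⟩ := Metric.mem_closure_iff.mp (hCc hy) _
      (Nat.one_div_pos_of_nat (α := ℝ) (n := n))
    refine ⟨U (a, n), ⟨(a, n), ⟨ha, trivial⟩, rfl⟩, ⟨y, ⟨hya.le, hy⟩, le_rfl⟩, ?_⟩
    rintro ⟨k, ⟨hk, -⟩, hkx⟩
    refine hball (Metric.mem_ball.mpr ?_) hkx
    have hk' : dist k a ≤ 1 / ((n : ℝ) + 1) := hk
    linarith [dist_triangle_right k y a]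

/-- **Antisymmetry of the stochastic order on ordered metric spaces.**
Let `X` be a metric space with a partial order whose graph is closed in `X × X`
(an ordered metric space).  Define the stochastic order on Radon probability
measures (inner regular w.r.t. compact sets) by `p ⪯ q` iff there is a
probability measure on `X × X` with first marginal `p`, second marginal `q`,
giving full measure to the closed set `{(x,y) | x ≤ y}` (i.e. supported on it).
Then `p ⪯ q` and `q ⪯ p` imply `p = q`. -/
theorem stochasticOrder_antisymm
    {X : Type*} [MetricSpace X] [PartialOrder X]
    [MeasurableSpace X] [BorelSpace X]
    (hclosed : IsClosed {z : X × X | z.1 ≤ z.2})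
    (p q : Measure X) [IsProbabilityMeasure p] [IsProbabilityMeasure q]
    [p.InnerRegular] [q.InnerRegular]
    (hpq : ∃ r : Measure (X × X), IsProbabilityMeasure r ∧
      r.map Prod.fst = p ∧ r.map Prod.snd = q ∧ r {z : X × X | z.1 ≤ z.2}ᶜ = 0)
    (hqp : ∃ s : Measure (X × X), IsProbabilityMeasure s ∧
      s.map Prod.fst = q ∧ s.map Prod.snd = p ∧ s {z : X × X | z.1 ≤ z.2}ᶜ = 0) :
    p = q := by
  have : OrderClosedTopology X := ⟨hclosed⟩
  obtain ⟨r, _, rfl, rfl, hr⟩ := hpq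
  obtain ⟨s, _, hs₁, hs₂, hs⟩ := hqp
  have hr' : ∀ᵐ z ∂r, z.1 ≤ z.2 := hr
  have hs' : ∀ᵐ z ∂s, z.1 ≤ z.2 := hs
  have hup (U : Set X) (hU : IsUpperSet U) (hm : MeasurableSet U) :
      r (Prod.snd ⁻¹' U) ≤ r (Prod.fst ⁻¹' U) := by
    rw [← Measure.map_apply measurable_snd hm, ← Measure.map_apply measurable_fst hm,
      ← hs₁, ← hs₂, Measure.map_apply measurable_snd hm, Measure.map_apply measurable_fst hm]
    refine measure_mono_ae ?_
    filter_upwards [hs'] with z hz hzU using hU hz hzU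
  have hcompact (C : Set X) (hC : IsCompact C) : r.map Prod.snd C ≤ r.map Prod.fst C := by
    obtain ⟨S, hS, hSU, hsep⟩ := hC.exists_countable_isClosed_isUpperSet
    have hnull : ∀ᵐ z ∂r, ∀ U ∈ S, ¬ (z.2 ∈ U ∧ z.1 ∉ U) := by
      refine (ae_ball_iff hS).mpr fun U hU => ?_
      obtain ⟨hcl, hU⟩ := hSU U hU
      exact measure_eq_zero_iff_ae_notMem.mp (measure_notMem_inter_mem_eq_zero hr' hU
        hcl.measurableSet (hup U hU hcl.measurableSet))
    rw [Measure.map_apply measurable_snd hC.measurableSet,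
      Measure.map_apply measurable_fst hC.measurableSet]
    refine measure_mono_ae ?_
    filter_upwards [hr', hnull] with z hz hzS hzC
    have hle : z.2 ≤ z.1 := by
      by_contra h
      obtain ⟨U, hU, hzU⟩ := hsep z.1 z.2 hzC h
      exact hzS U hU hzU
    change z.1 ∈ C
    rw [le_antisymm hz hle]
    exact hzC
  symm
  refine Measure.eq_of_le_of_isProbabilityMeasure (Measure.le_iff.mpr fun A hA => ?_)
  rw [hA.measure_eq_iSup_isCompact]
  exact iSup₂_le fun C hCA => iSup_le fun hC => (hcompact C hC).trans (measure_mono hCA)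
end

section
/- Let X be an ordered metric space (a metric space with a partial order whose graph {(x,y) : x ≤ y} is closed in X × X), and let p, q be Radon probability measures on X. Then p(C) ≤ q(C) holds for every closed upper set C ⊆ X if and only if p(U) ≤ q(U) holds for every open upper set U ⊆ X. -/
open MeasureTheory

/-- In an order-closed space, the upper closure of a compact set is closed. -/
theorem IsCompact.isClosed_upperClosure {X : Type*} [TopologicalSpace X] [Preorder X]
    [OrderClosedTopology X] {K : Set X} (hK : IsCompact K) :
    IsClosed (upperClosure K : Set X) := by
  have : CompactSpace K := isCompact_iff_compactSpace.mp hK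
  have hgraph : IsClosed {z : K × X | (z.1 : X) ≤ z.2} :=
    isClosed_le (continuous_subtype_val.comp continuous_fst) continuous_snd
  convert isClosedMap_snd_of_compactSpace _ hgraph
  ext y
  simp

/-- An inequality between measures on closed upper sets extends to open upper sets if the smaller
measure is inner regular. -/
theorem measure_le_of_isOpen_isUpperSet {X : Type*} [TopologicalSpace X] [Preorder X]
    [OrderClosedTopology X] [MeasurableSpace X] [OpensMeasurableSpace X]
    {p q : Measure X} [p.InnerRegular]
    (h : ∀ C : Set X, IsClosed C → IsUpperSet C → p C ≤ q C)
    {U : Set X} (hU : IsOpen U) (hUpper : IsUpperSet U) : p U ≤ q U := by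
  refine le_of_forall_lt fun r hr ↦ ?_
  obtain ⟨K, hKU, hK, hrK⟩ := hU.measurableSet.exists_lt_isCompact hr
  calc
    r < p K := hrK
    _ ≤ p (upperClosure K) := measure_mono subset_upperClosure
    _ ≤ q (upperClosure K) := h _ hK.isClosed_upperClosure (upperClosure K).upper
    _ ≤ q U := measure_mono (upperClosure_min hKU hUpper)

/-- An inequality between measures on closed lower sets extends to open lower sets if the smaller
measure is inner regular. -/
theorem measure_le_of_isOpen_isLowerSet {X : Type*} [TopologicalSpace X] [Preorder X]
    [hX : OrderClosedTopology X] [MeasurableSpace X] [OpensMeasurableSpace X]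
    {p q : Measure X} [p.InnerRegular]
    (h : ∀ C : Set X, IsClosed C → IsLowerSet C → p C ≤ q C)
    {U : Set X} (hU : IsOpen U) (hLower : IsLowerSet U) : p U ≤ q U := by
  let : Preorder X := inferInstanceAs (Preorder Xᵒᵈ)
  have : OrderClosedTopology X := ⟨hX.isClosed_le'.preimage continuous_swap⟩
  exact measure_le_of_isOpen_isUpperSet (fun C hC hCU ↦ h C hC fun _ _ hab ↦ hCU hab) hU
    fun _ _ hab ↦ hLower hab

/-- Taking complements reverses an inequality between probability measures. -/
theorem prob_le_of_prob_compl_le {X : Type*} [MeasurableSpace X] {p q : Measure X}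
    [IsProbabilityMeasure p] [IsProbabilityMeasure q] {s : Set X} (hs : MeasurableSet s)
    (h : p sᶜ ≤ q sᶜ) : q s ≤ p s := by
  rw [← compl_compl s, prob_compl_eq_one_sub hs.compl, prob_compl_eq_one_sub hs.compl]
  exact tsub_le_tsub_left h 1

/-- For Radon probability measures `p, q` on an ordered metric space `X`
(a metric space with a partial order whose graph is closed in `X × X`),
`p C ≤ q C` holds for every closed upper set `C` if and only if
`p U ≤ q U` holds for every open upper set `U`. -/
theorem closed_upper_iff_open_upper
    {X : Type*} [MetricSpace X] [PartialOrder X]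
    [MeasurableSpace X] [BorelSpace X]
    (hclosed : IsClosed {z : X × X | z.1 ≤ z.2})
    (p q : Measure X) [IsProbabilityMeasure p] [IsProbabilityMeasure q]
    [p.InnerRegular] [q.InnerRegular] :
    (∀ C : Set X, IsClosed C → IsUpperSet C → p C ≤ q C) ↔
      (∀ U : Set X, IsOpen U → IsUpperSet U → p U ≤ q U) := by
  have : OrderClosedTopology X := ⟨hclosed⟩
  refine ⟨fun h U hU hUpper ↦ measure_le_of_isOpen_isUpperSet h hU hUpper, fun h C hC hUpper ↦ ?_⟩
  refine prob_le_of_prob_compl_le hC.measurableSet ?_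
  refine measure_le_of_isOpen_isLowerSet (fun L hL hLower ↦ ?_) hC.isOpen_compl hUpper.compl
  exact prob_le_of_prob_compl_le hL.measurableSet (h _ hL.isOpen_compl hLower.compl)
end

section
/- (Strassen's theorem for ordered Polish spaces.) Let X be a Polish space equipped with a partial order ≤ whose graph {(x,y) : x ≤ y} is closed in X × X, and let p, q be Borel probability measures on X. If p(C) ≤ q(C) for every closed upper set C ⊆ X, then there exists a probability measure r on X × X whose first marginal is p, whose second marginal is q, and whose support is contained in {(x,y) : x ≤ y}. -/
open MeasureTheory Filter Topology

/-- If every set has `μ`-measure at most the `ν`-measure of its set of `E`-neighbours, then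
`F i ≤ H j` along `E` implies `∫ F ∂μ ≤ ∫ H ∂ν`. -/
theorem integral_le_integral_of_measure_le_neighbors {ι κ : Type*} [Finite ι] [Finite κ]
    [MeasurableSpace ι] [MeasurableSpace κ] [MeasurableSingletonClass ι]
    [MeasurableSingletonClass κ] (μ : Measure ι) (ν : Measure κ)
    [IsProbabilityMeasure μ] [IsProbabilityMeasure ν] (E : ι → κ → Prop)
    (h : ∀ I : Set ι, μ I ≤ ν {j | ∃ i ∈ I, E i j}) {F : ι → ℝ} {H : κ → ℝ}
    (hFH : ∀ i j, E i j → F i ≤ H j) : ∫ i, F i ∂μ ≤ ∫ j, H j ∂ν := by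
  obtain ⟨m, hm⟩ := (Set.finite_range F).bddBelow
  obtain ⟨m', hm'⟩ := (Set.finite_range H).bddBelow
  have hF0 : ∀ i, 0 ≤ F i - min m m' := fun i ↦
    sub_nonneg.2 ((min_le_left _ _).trans (hm ⟨i, rfl⟩))
  have hH0 : ∀ j, 0 ≤ H j - min m m' := fun j ↦
    sub_nonneg.2 ((min_le_right _ _).trans (hm' ⟨j, rfl⟩))
  have key : ∫⁻ i, ENNReal.ofReal (F i - min m m') ∂μ
      ≤ ∫⁻ j, ENNReal.ofReal (H j - min m m') ∂ν := by
    rw [lintegral_eq_lintegral_meas_lt μ (.of_forall hF0) (measurable_of_finite _).aemeasurable,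
      lintegral_eq_lintegral_meas_lt ν (.of_forall hH0) (measurable_of_finite _).aemeasurable]
    refine lintegral_mono fun t ↦ (h _).trans (measure_mono ?_)
    rintro j ⟨i, hi, hij⟩
    have := hFH i j hij
    simp only [Set.mem_ofPred_eq] at hi ⊢
    linarith
  have key' : ∫ i, (F i - min m m') ∂μ ≤ ∫ j, (H j - min m m') ∂ν := by
    rw [integral_eq_lintegral_of_nonneg_ae (.of_forall hF0)
        (measurable_of_finite _).aestronglyMeasurable,
      integral_eq_lintegral_of_nonneg_ae (.of_forall hH0)
        (measurable_of_finite _).aestronglyMeasurable]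
    refine ENNReal.toReal_mono ?_ key
    exact (Integrable.of_finite (f := fun j ↦ H j - min m m')).lintegral_lt_top.ne
  rw [integral_sub .of_finite .of_finite, integral_sub .of_finite .of_finite] at key'
  simpa using key'

/-- **Strassen's theorem on finite types**, with the coupling given as a matrix. -/
theorem exists_matrix_of_measure_le_neighbors {ι κ : Type*} [Fintype ι] [Fintype κ]
    [MeasurableSpace ι] [MeasurableSpace κ] [MeasurableSingletonClass ι]
    [MeasurableSingletonClass κ] (μ : Measure ι) (ν : Measure κ)
    [IsProbabilityMeasure μ] [IsProbabilityMeasure ν] (E : ι → κ → Prop)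
    (h : ∀ I : Set ι, μ I ≤ ν {j | ∃ i ∈ I, E i j}) :
    ∃ w : ι → κ → ℝ, (∀ i j, 0 ≤ w i j) ∧ (∀ i j, ¬ E i j → w i j = 0) ∧
      (∀ i, ∑ j, w i j = μ.real {i}) ∧ (∀ j, ∑ i, w i j = ν.real {j}) := by
  classical
  let L : (ι × κ → ℝ) →ₗ[ℝ] (ι → ℝ) × (κ → ℝ) :=
    { toFun := fun w ↦ (fun i ↦ ∑ j, w (i, j), fun j ↦ ∑ i, w (i, j))
      map_add' := fun v w ↦ by ext <;> simp [Finset.sum_add_distrib]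
      map_smul' := fun c w ↦ by ext <;> simp [Finset.mul_sum] }
  let V : Submodule ℝ (ι × κ → ℝ) :=
    ⨅ e ∈ {e : ι × κ | ¬ E e.1 e.2}, LinearMap.ker (LinearMap.proj e)
  have hV : ∀ w, w ∈ V ↔ ∀ e : ι × κ, ¬ E e.1 e.2 → w e = 0 := fun w ↦ by
    simp [V, Submodule.mem_iInf]
  let S : Set (ι × κ → ℝ) := stdSimplex ℝ (ι × κ) ∩ V
  have hScomp : IsCompact (L '' S) :=
    ((isCompact_stdSimplex ℝ (ι × κ)).inter_right V.closed_of_finiteDimensional).image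
      L.continuous_of_finiteDimensional
  have hSconv : Convex ℝ (L '' S) := ((convex_stdSimplex ℝ _).inter V.convex).linear_image L
  by_cases hmem : (fun i ↦ μ.real {i}, fun j ↦ ν.real {j}) ∈ L '' S
  · obtain ⟨w, ⟨hw, hwV⟩, hLw⟩ := hmem
    refine ⟨fun i j ↦ w (i, j), fun i j ↦ hw.1 _, fun i j hij ↦ (hV w).1 hwV _ hij,
      fun i ↦ congrFun (congrArg Prod.fst hLw) i, fun j ↦ congrFun (congrArg Prod.snd hLw) j⟩
  exfalso
  obtain ⟨φ, u, hφ, hu⟩ := geometric_hahn_banach_closed_point hSconv hScomp.isClosed hmem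
  have hφE : ∀ i j, E i j → φ (Pi.single i 1, 0) ≤ u - φ (0, Pi.single j 1) := by
    intro i j hij
    have hS : Pi.single (i, j) 1 ∈ S := by
      refine ⟨single_mem_stdSimplex _ _, (hV _).2 fun e he ↦ ?_⟩
      rw [Pi.single_eq_of_ne]
      rintro rfl
      exact he hij
    have hL : L (Pi.single (i, j) 1) = (Pi.single i 1, 0) + (0, Pi.single j 1) := by
      ext k
      · simp [L, Pi.single_apply, Prod.ext_iff, ite_and]
      · simp [L, Pi.single_apply, Prod.ext_iff, ite_and]
    have := hφ _ (Set.mem_image_of_mem L hS)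
    rw [hL, map_add] at this
    linarith
  have hint := integral_le_integral_of_measure_le_neighbors μ ν E h hφE
  rw [integral_sub .of_finite .of_finite, integral_const, integral_fintype .of_finite,
    integral_fintype .of_finite] at hint
  have hdecomp : ((fun i ↦ μ.real {i}, fun j ↦ ν.real {j}) : (ι → ℝ) × (κ → ℝ))
      = ∑ i, μ.real {i} • (Pi.single i 1, 0) + ∑ j, ν.real {j} • (0, Pi.single j 1) := by
    ext k <;> simp [Prod.fst_sum, Prod.snd_sum, Finset.sum_apply, Pi.single_apply]
  rw [hdecomp, map_add, map_sum, map_sum] at hu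
  simp only [map_smul, smul_eq_mul] at hu
  simp only [probReal_univ, smul_eq_mul, one_mul] at hint
  linarith

open ProbabilityTheory in
/-- A finite measurable labelling under which `p` and `q` satisfy Hall's condition for a relation
`E` admits a coupling of `p` and `q` concentrated on pairs with related labels. -/
theorem exists_coupling_of_measure_preimage_le {X ι : Type*} [MeasurableSpace X] [Fintype ι]
    [MeasurableSpace ι] [MeasurableSingletonClass ι] (p q : Measure X)
    [IsProbabilityMeasure p] [IsProbabilityMeasure q] {π : X → ι} (hπ : Measurable π)
    (E : ι → ι → Prop) (h : ∀ I : Set ι, p (π ⁻¹' I) ≤ q (π ⁻¹' {j | ∃ i ∈ I, E i j})) :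
    ∃ r : Measure (X × X), r.map Prod.fst = p ∧ r.map Prod.snd = q ∧
      r {z | ¬ E (π z.1) (π z.2)} = 0 := by
  have := Measure.isProbabilityMeasure_map (μ := p) hπ.aemeasurable
  have := Measure.isProbabilityMeasure_map (μ := q) hπ.aemeasurable
  obtain ⟨w, hw0, hwE, hw1, hw2⟩ := exists_matrix_of_measure_le_neighbors (p.map π) (q.map π) E
    fun I ↦ by
      rw [Measure.map_apply hπ I.toFinite.measurableSet,
        Measure.map_apply hπ (Set.toFinite _).measurableSet]
      exact h I
  have hs1 : ∀ i, ∑ j, ENNReal.ofReal (w i j) = p (π ⁻¹' {i}) := fun i ↦ by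
    rw [← ENNReal.ofReal_sum_of_nonneg fun j _ ↦ hw0 i j, hw1 i, ofReal_measureReal,
      Measure.map_apply hπ (measurableSet_singleton i)]
  have hs2 : ∀ j, ∑ i, ENNReal.ofReal (w i j) = q (π ⁻¹' {j}) := fun j ↦ by
    rw [← ENNReal.ofReal_sum_of_nonneg fun i _ ↦ hw0 i j, hw2 j, ofReal_measureReal,
      Measure.map_apply hπ (measurableSet_singleton j)]
  have hc1 : ∀ i j, ENNReal.ofReal (w i j) * p[|π ← i] Set.univ = ENNReal.ofReal (w i j) := by
    intro i j
    by_cases hp : p (π ⁻¹' {i}) = 0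
    · rw [← hs1, Finset.sum_eq_zero_iff] at hp
      rw [hp j (Finset.mem_univ j), zero_mul]
    · have := cond_isProbabilityMeasure hp
      rw [measure_univ, mul_one]
  have hc2 : ∀ i j, ENNReal.ofReal (w i j) * q[|π ← j] Set.univ = ENNReal.ofReal (w i j) := by
    intro i j
    by_cases hp : q (π ⁻¹' {j}) = 0
    · rw [← hs2, Finset.sum_eq_zero_iff] at hp
      rw [hp i (Finset.mem_univ i), zero_mul]
    · have := cond_isProbabilityMeasure hp
      rw [measure_univ, mul_one]
  refine ⟨∑ i, ∑ j, ENNReal.ofReal (w i j) • (p[|π ← i]).prod (q[|π ← j]), ?_, ?_, ?_⟩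
  · simp only [← Measure.mapₗ_apply_of_measurable measurable_fst, map_sum, map_smul]
    simp only [Measure.mapₗ_apply_of_measurable measurable_fst, Measure.map_fst_prod, smul_smul,
      hc2, ← Finset.sum_smul, hs1]
    exact sum_meas_smul_cond_fiber hπ p
  · rw [Finset.sum_comm]
    simp only [← Measure.mapₗ_apply_of_measurable measurable_snd, map_sum, map_smul]
    simp only [Measure.mapₗ_apply_of_measurable measurable_snd, Measure.map_snd_prod, smul_smul,
      hc1, ← Finset.sum_smul, hs2]
    exact sum_meas_smul_cond_fiber hπ q
  · simp only [Measure.coe_finsetSum, Finset.sum_apply, Measure.smul_apply, smul_eq_mul,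
      Finset.sum_eq_zero_iff, Finset.mem_univ, true_imp_iff, mul_eq_zero]
    intro i j
    by_cases hij : E i j
    · right
      have h1 : ∀ᵐ x ∂p[|π ← i], π x = i := ae_cond_mem (hπ (measurableSet_singleton i))
      have h2 : ∀ᵐ x ∂q[|π ← j], π x = j := ae_cond_mem (hπ (measurableSet_singleton j))
      have h3 : ∀ᵐ z ∂(p[|π ← i]).prod (q[|π ← j]), E (π z.1) (π z.2) := by
        filter_upwards [Measure.quasiMeasurePreserving_fst.ae h1,
          Measure.quasiMeasurePreserving_snd.ae h2] with z hz1 hz2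
        rwa [hz1, hz2]
      exact h3
    · left
      rw [hwE i j hij, ENNReal.ofReal_zero]

/-- If the graph of the order is closed, then the upper closure of a compact set is closed. -/
theorem IsCompact.isClosed_upperClosure_of_isClosed_le {X : Type*} [TopologicalSpace X]
    [PartialOrder X] (hclosed : IsClosed {z : X × X | z.1 ≤ z.2}) {C : Set X} (hC : IsCompact C) :
    IsClosed (upperClosure C : Set X) := by
  have : CompactSpace C := isCompact_iff_compactSpace.1 hC
  have hcl : IsClosed {z : C × X | (z.1 : X) ≤ z.2} :=
    hclosed.preimage (by fun_prop : Continuous fun z : C × X ↦ ((z.1 : X), z.2))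
  convert isClosedMap_snd_of_compactSpace _ hcl using 1
  ext y
  simp [mem_upperClosure]

/-- A measurable function to `ℕ` is large only on sets of small measure. -/
theorem eventually_measure_preimage_Ici_le {X : Type*} [MeasurableSpace X] (p : Measure X)
    [IsFiniteMeasure p] {n : X → ℕ} (hn : Measurable n) {ε : ENNReal} (hε : ε ≠ 0) :
    ∀ᶠ N in atTop, p (n ⁻¹' Set.Ici N) ≤ ε := by
  have ht : Tendsto (fun N ↦ p (n ⁻¹' Set.Ici N)) atTop (𝓝 (p (⋂ N, n ⁻¹' Set.Ici N))) :=
    tendsto_measure_iInter_atTop (fun N ↦ (hn measurableSet_Ici).nullMeasurableSet)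
      (fun a b hab ↦ Set.preimage_mono (Set.Ici_subset_Ici.2 hab)) ⟨0, measure_ne_top _ _⟩
  have h0 : ⋂ N, n ⁻¹' Set.Ici N = ∅ := by
    ext x
    simp only [Set.mem_iInter, Set.mem_preimage, Set.mem_Ici, Set.mem_empty_iff_false, iff_false,
      not_forall]
    exact ⟨n x + 1, by simp⟩
  rw [h0, measure_empty] at ht
  exact (ht.eventually_lt_const (pos_iff_ne_zero.2 hε)).mono fun _ ↦ le_of_lt

/-- Under stochastic domination there are couplings giving almost full mass to any metric
neighbourhood of the graph of the order. -/
theorem exists_coupling_compl_thickening_le {X : Type*} [MetricSpace X] [CompleteSpace X]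
    [SecondCountableTopology X] [PartialOrder X] [MeasurableSpace X] [BorelSpace X]
    (hclosed : IsClosed {z : X × X | z.1 ≤ z.2})
    (p q : Measure X) [IsProbabilityMeasure p] [IsProbabilityMeasure q]
    (h : ∀ C : Set X, IsClosed C → IsUpperSet C → p C ≤ q C)
    {ε : ENNReal} (hε : ε ≠ 0) {δ : ℝ} (hδ : 0 < δ) :
    ∃ r : Measure (X × X), r.map Prod.fst = p ∧ r.map Prod.snd = q ∧
      r (Metric.thickening δ {z : X × X | z.1 ≤ z.2})ᶜ ≤ ε := by
  classical
  have : Nonempty X := nonempty_of_isProbabilityMeasure p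
  have hex : ∀ x : X, ∃ k, dist x (TopologicalSpace.denseSeq X k) < δ / 2 := fun x ↦
    (TopologicalSpace.denseRange_denseSeq X).exists_dist_lt x (half_pos hδ)
  let n : X → ℕ := fun x ↦ Nat.find (hex x)
  have hn : Measurable n := measurable_find hex fun k ↦
    (isOpen_lt (by fun_prop) continuous_const).measurableSet
  have hnd : ∀ x y, n x = n y → dist x y < δ := fun x y hxy ↦ by
    have hx : dist x (TopologicalSpace.denseSeq X (n x)) < δ / 2 := Nat.find_spec (hex x)
    have hy : dist y (TopologicalSpace.denseSeq X (n y)) < δ / 2 := Nat.find_spec (hex y)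
    rw [hxy] at hx
    linarith [dist_triangle_right x y (TopologicalSpace.denseSeq X (n y))]
  have hε2 : ε / 2 ≠ 0 := (ENNReal.half_pos hε).ne'
  obtain ⟨N, hNp, hNq⟩ := ((eventually_measure_preimage_Ici_le p hn hε2).and
    (eventually_measure_preimage_Ici_le q hn hε2)).exists
  let π : X → Fin (N + 1) := fun x ↦ ⟨min (n x) N, by omega⟩
  have hπ : Measurable π :=
    (measurable_of_countable fun k : ℕ ↦ (⟨min k N, by omega⟩ : Fin (N + 1))).comp hn
  have hπlast : ∀ x, N ≤ n x → π x = Fin.last N := fun x hx ↦ Fin.ext (min_eq_right hx)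
  have hπd : ∀ x y, π x = π y → n y < N → dist x y < δ := fun x y hxy hy ↦ by
    refine hnd x y ?_
    have : min (n x) N = min (n y) N := congrArg Fin.val hxy
    omega
  let E : Fin (N + 1) → Fin (N + 1) → Prop := fun i j ↦
    i = Fin.last N ∨ j = Fin.last N ∨ ∃ x y, x ≤ y ∧ π x = i ∧ π y = j
  have hHall : ∀ I : Set (Fin (N + 1)), p (π ⁻¹' I) ≤ q (π ⁻¹' {j | ∃ i ∈ I, E i j}) := by
    intro I
    rw [(hπ I.toFinite.measurableSet).measure_eq_iSup_isCompact p]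
    refine iSup_le fun C ↦ iSup_le fun hCI ↦ iSup_le fun hC ↦ ?_
    calc p C ≤ p (upperClosure C : Set X) := measure_mono subset_upperClosure
      _ ≤ q (upperClosure C : Set X) :=
        h _ (hC.isClosed_upperClosure_of_isClosed_le hclosed) (upperClosure C).upper
      _ ≤ _ := measure_mono ?_
    rintro y ⟨x, hx, hxy⟩
    exact ⟨π x, hCI hx, .inr (.inr ⟨x, y, hxy, rfl, rfl⟩)⟩
  obtain ⟨r, hr1, hr2, hr⟩ := exists_coupling_of_measure_preimage_le p q hπ E hHall
  refine ⟨r, hr1, hr2, ?_⟩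
  have hsub : (Metric.thickening δ {z : X × X | z.1 ≤ z.2})ᶜ ⊆
      {z | ¬ E (π z.1) (π z.2)} ∪
        (Prod.fst ⁻¹' (n ⁻¹' Set.Ici N) ∪ Prod.snd ⁻¹' (n ⁻¹' Set.Ici N)) := by
    rintro ⟨a, b⟩ hab
    by_contra hcon
    simp only [Set.mem_union, Set.mem_ofPred_eq, Set.mem_preimage, Set.mem_Ici, not_or, not_not,
      not_le] at hcon
    obtain ⟨hE, ha, hb⟩ := hcon
    have hlast : ∀ x, n x < N → π x ≠ Fin.last N := fun x hx hx' ↦ by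
      have : min (n x) N = N := congrArg Fin.val hx'
      omega
    obtain hE | hE | ⟨x, y, hxy, hx, hy⟩ := hE
    · exact hlast a ha hE
    · exact hlast b hb hE
    · refine hab (Metric.mem_thickening_iff.2 ⟨(x, y), hxy, ?_⟩)
      rw [dist_comm, Prod.dist_eq]
      exact max_lt (hπd x a hx ha) (hπd y b hy hb)
  calc _ ≤ _ := measure_mono hsub
    _ ≤ _ := measure_union_le _ _
    _ ≤ 0 + (r (Prod.fst ⁻¹' (n ⁻¹' Set.Ici N)) + r (Prod.snd ⁻¹' (n ⁻¹' Set.Ici N))) :=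
      add_le_add hr.le (measure_union_le _ _)
    _ = p (n ⁻¹' Set.Ici N) + q (n ⁻¹' Set.Ici N) := by
      rw [zero_add, ← Measure.map_apply measurable_fst (hn measurableSet_Ici),
        ← Measure.map_apply measurable_snd (hn measurableSet_Ici), hr1, hr2]
    _ ≤ ε / 2 + ε / 2 := add_le_add hNp hNq
    _ = ε := ENNReal.add_halves ε

/-- The couplings of two probability measures on a Polish space form a compact set. -/
theorem isCompact_setOfPred_coupling {X Y : Type*} [TopologicalSpace X] [PolishSpace X]
    [MeasurableSpace X] [BorelSpace X] [TopologicalSpace Y] [PolishSpace Y]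
    [MeasurableSpace Y] [BorelSpace Y] (p : Measure X) (q : Measure Y)
    [IsProbabilityMeasure p] [IsProbabilityMeasure q] :
    IsCompact {r : ProbabilityMeasure (X × Y) |
      (r : Measure (X × Y)).map Prod.fst = p ∧ (r : Measure (X × Y)).map Prod.snd = q} := by
  let := TopologicalSpace.upgradeIsCompletelyMetrizable X
  let := TopologicalSpace.upgradeIsCompletelyMetrizable Y
  set S := {r : ProbabilityMeasure (X × Y) |
      (r : Measure (X × Y)).map Prod.fst = p ∧ (r : Measure (X × Y)).map Prod.snd = q} with hS
  have htight :
      IsTightMeasureSet {((μ : ProbabilityMeasure (X × Y)) : Measure (X × Y)) | μ ∈ S} := by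
    refine IsTightMeasureSet.prodMk
      ((isTightMeasureSet_singleton (μ := p)).subset ?_)
      ((isTightMeasureSet_singleton (μ := q)).subset ?_)
    · rintro _ ⟨_, ⟨r, hr, rfl⟩, rfl⟩
      exact hr.1
    · rintro _ ⟨_, ⟨r, hr, rfl⟩, rfl⟩
      exact hr.2
  have hcl : IsClosed S := by
    let p' : ProbabilityMeasure X := ⟨p, inferInstance⟩
    let q' : ProbabilityMeasure Y := ⟨q, inferInstance⟩
    have h1 := isClosed_singleton (x := p').preimage
      (ProbabilityMeasure.continuous_map (continuous_fst (X := X) (Y := Y)))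
    have h2 := isClosed_singleton (x := q').preimage
      (ProbabilityMeasure.continuous_map (continuous_snd (X := X) (Y := Y)))
    convert h1.inter h2 using 1
    ext r
    simp only [hS, Set.mem_ofPred_eq, Set.mem_inter_iff, Set.mem_preimage, Set.mem_singleton_iff]
    exact ⟨fun h ↦ ⟨Subtype.ext h.1, Subtype.ext h.2⟩,
      fun h ↦ ⟨congrArg Subtype.val h.1, congrArg Subtype.val h.2⟩⟩
  simpa only [hcl.closure_eq] using isCompact_closure_of_isTightMeasureSet htight

/-- **Strassen's theorem for ordered Polish spaces.**
Let `X` be a Polish space with a partial order whose graph is closed in `X × X`,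
and let `p, q` be Borel probability measures on `X`.  If `p C ≤ q C` for every
closed upper set `C ⊆ X`, then there exists a probability measure `r` on `X × X`
with first marginal `p`, second marginal `q`, supported on the closed set
`{(x,y) | x ≤ y}` (i.e. giving its complement measure zero). -/
theorem strassen_ordered_polish
    {X : Type*} [TopologicalSpace X] [PolishSpace X] [PartialOrder X]
    [MeasurableSpace X] [BorelSpace X]
    (hclosed : IsClosed {z : X × X | z.1 ≤ z.2})
    (p q : Measure X) [IsProbabilityMeasure p] [IsProbabilityMeasure q]
    (h : ∀ C : Set X, IsClosed C → IsUpperSet C → p C ≤ q C) :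
    ∃ r : Measure (X × X), IsProbabilityMeasure r ∧
      r.map Prod.fst = p ∧ r.map Prod.snd = q ∧ r {z : X × X | z.1 ≤ z.2}ᶜ = 0 := by
  let := TopologicalSpace.upgradeIsCompletelyMetrizable X
  set R := {z : X × X | z.1 ≤ z.2}
  obtain ⟨δ, δ_anti, δ_pos, δ_lim⟩ := exists_seq_strictAnti_tendsto (0 : ℝ)
  choose r hr1 hr2 hr using fun n ↦ exists_coupling_compl_thickening_le hclosed p q h
    (ENNReal.ofReal_pos.2 (δ_pos n)).ne' (δ_pos n)
  have hprob : ∀ n, IsProbabilityMeasure (r n) := fun n ↦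
    ⟨by rw [← Set.preimage_univ (f := Prod.fst), ← Measure.map_apply measurable_fst .univ, hr1,
      measure_univ]⟩
  let s : ℕ → ProbabilityMeasure (X × X) := fun n ↦ ⟨r n, hprob n⟩
  let 𝒰 : Ultrafilter ℕ := Ultrafilter.of atTop
  have h𝒰 : (𝒰 : Filter ℕ) ≤ atTop := Ultrafilter.of_le atTop
  obtain ⟨ρ, ⟨hρ1, hρ2⟩, hρ⟩ := (isCompact_setOfPred_coupling p q).ultrafilter_le_nhds (𝒰.map s)
    (by
      rw [le_principal_iff, Ultrafilter.coe_map, mem_map]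
      exact univ_mem' fun n ↦ ⟨hr1 n, hr2 n⟩)
  have hlim : Tendsto s 𝒰 (𝓝 ρ) := hρ
  refine ⟨ρ, inferInstance, hρ1, hρ2, ?_⟩
  have hR : Rᶜ = ⋃ m, (Metric.cthickening (δ m) R)ᶜ := by
    rw [← Set.compl_iInter, ← Set.biInter_range (f := δ) (g := fun ε ↦ Metric.cthickening ε R),
      ← Metric.closure_eq_iInter_cthickening', hclosed.closure_eq]
    intro ε hε
    obtain ⟨n, hn⟩ := (δ_lim.eventually_lt_const hε).exists
    exact ⟨δ n, ⟨n, rfl⟩, δ_pos n, hn.le⟩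
  rw [hR, measure_iUnion_null_iff]
  intro m
  have hopen := ProbabilityMeasure.le_liminf_measure_open_of_tendsto hlim
    (Metric.isClosed_cthickening (δ := δ m) (E := R)).isOpen_compl
  have hto : Tendsto (fun n ↦ (s n : Measure (X × X)) (Metric.cthickening (δ m) R)ᶜ) 𝒰 (𝓝 0) := by
    have h0 : Tendsto (fun n ↦ ENNReal.ofReal (δ n)) 𝒰 (𝓝 0) := by
      simpa using ENNReal.tendsto_ofReal (δ_lim.mono_left h𝒰)
    refine tendsto_of_tendsto_of_tendsto_of_le_of_le' tendsto_const_nhds h0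
      (Eventually.of_forall fun _ ↦ zero_le) (h𝒰 ?_)
    filter_upwards [eventually_ge_atTop m] with n hn
    refine (measure_mono (Set.compl_subset_compl.2 ?_)).trans (hr n)
    exact (Metric.thickening_subset_cthickening _ _).trans
      (Metric.cthickening_mono (δ_anti.antitone hn) _)
  rw [hto.liminf_eq] at hopen
  exact le_antisymm hopen zero_le
end

section
/- Let X be an ordered metric space (a metric space with a partial order whose graph {(x,y) : x ≤ y} is closed in X × X). Define p ⪯ q for Radon probability measures p, q on X to mean that there exists a probability measure on X × X with marginals p and q supported on {(x,y) : x ≤ y}. Then ⪯ is transitive: if p ⪯ q and q ⪯ r, then p ⪯ r. -/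
open MeasureTheory

/-- A finite inner regular measure is concentrated on a σ-compact set. -/
theorem exists_isSigmaCompact_measure_compl_eq_zero {X : Type*} [TopologicalSpace X] [T2Space X]
    [MeasurableSpace X] [BorelSpace X] (p : Measure X) [IsFiniteMeasure p] [p.InnerRegular] :
    ∃ S : Set X, IsSigmaCompact S ∧ p Sᶜ = 0 := by
  have h (n : ℕ) : ∃ K : Set X, IsCompact K ∧ p Kᶜ < (n : ENNReal)⁻¹ := by
    obtain ⟨K, -, hK, hlt⟩ := MeasurableSet.univ.exists_isCompact_sdiff_lt
      (measure_ne_top p Set.univ) (ε := (n : ENNReal)⁻¹) (by simp)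
    exact ⟨K, hK, by rwa [Set.compl_eq_univ_sdiff]⟩
  choose K hK hlt using h
  refine ⟨⋃ n, K n, ⟨K, hK, rfl⟩, le_antisymm (ENNReal.le_of_forall_pos_le_add ?_) bot_le⟩
  intro ε hε _
  obtain ⟨n, hn⟩ := ENNReal.exists_inv_nat_lt (ENNReal.coe_ne_zero.2 hε.ne')
  rw [zero_add]
  exact (measure_mono (Set.compl_subset_compl.2 (Set.subset_iUnion K n))).trans
    ((hlt n).le.trans hn.le)

theorem IsSigmaCompact.measurableSet {X : Type*} [TopologicalSpace X] [T2Space X]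
    [MeasurableSpace X] [OpensMeasurableSpace X] {S : Set X} (hS : IsSigmaCompact S) :
    MeasurableSet S := by
  obtain ⟨K, hK, rfl⟩ := hS
  exact MeasurableSet.iUnion fun n => (hK n).measurableSet

theorem IsSigmaCompact.union {X : Type*} [TopologicalSpace X] {S T : Set X}
    (hS : IsSigmaCompact S) (hT : IsSigmaCompact T) : IsSigmaCompact (S ∪ T) := by
  obtain ⟨K, hK, rfl⟩ := hS
  obtain ⟨L, hL, rfl⟩ := hT
  exact ⟨fun n => K n ∪ L n, fun n => (hK n).union (hL n), Set.iUnion_union_distrib K L⟩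

theorem MeasurableEquiv.standardBorelSpace {α β : Type*} [MeasurableSpace α] [MeasurableSpace β]
    [h : StandardBorelSpace β] (e : α ≃ᵐ β) : StandardBorelSpace α := by
  obtain ⟨τ, hB, hP⟩ := h.polish
  let _ : TopologicalSpace α := τ.induced e
  have : BorelSpace α :=
    ⟨by rw [borel_comap, ← hB.measurable_eq, e.measurableEmbedding.comap_eq]⟩
  exact ⟨_, this, e.toEquiv.polishSpace_induced⟩

/-- The Borel structure of a σ-compact metric space is standard, as the space is a σ-compact, hence
Borel, subset of its completion. -/
theorem standardBorelSpace_of_sigmaCompactSpace (S : Type*) [MetricSpace S] [SigmaCompactSpace S]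
    [MeasurableSpace S] [BorelSpace S] : StandardBorelSpace S := by
  have : SecondCountableTopology S := EMetric.secondCountable_of_sigmaCompact S
  let C := UniformSpace.Completion S
  let _ : MeasurableSpace C := borel C
  have : BorelSpace C := ⟨rfl⟩
  have : SecondCountableTopology C := UniformSpace.secondCountable_of_separable C
  have he : Topology.IsEmbedding ((↑) : S → C) :=
    UniformSpace.Completion.coe_isometry.isEmbedding
  have hr : MeasurableSet (Set.range ((↑) : S → C)) :=
    (isSigmaCompact_range he.continuous).measurableSet
  have : StandardBorelSpace (Set.range ((↑) : S → C)) := hr.standardBorel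
  exact (he.measurableEmbedding hr).equivRange.standardBorelSpace

/-- The composition of two couplings of probability measures, obtained by gluing along the common
marginal. -/
theorem exists_glued_coupling {α β γ : Type*} [MeasurableSpace α] [MeasurableSpace β]
    [MeasurableSpace γ] [StandardBorelSpace γ] [Nonempty γ]
    (μ : Measure (α × β)) (ν : Measure (β × γ)) [IsProbabilityMeasure μ] [IsProbabilityMeasure ν]
    (h : μ.snd = ν.fst) :
    ∃ m : Measure ((α × β) × γ), IsProbabilityMeasure m ∧
      m.map Prod.fst = μ ∧ m.map (fun z => (z.1.2, z.2)) = ν := by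
  refine ⟨μ.compProd (ν.condKernel.comap Prod.snd measurable_snd), inferInstance,
    Measure.fst_compProd _ _, ?_⟩
  conv_rhs => rw [← ν.disintegrate ν.condKernel, ← h]
  have hg : Measurable fun z : (α × β) × γ => (z.1.2, z.2) := by fun_prop
  ext s hs
  rw [Measure.map_apply hg hs, Measure.compProd_apply (hg hs), Measure.compProd_apply hs,
    Measure.snd, lintegral_map (ProbabilityTheory.Kernel.measurable_kernel_prodMk_left hs)
      measurable_snd]
  rfl

/-- Transitivity of the stochastic order on a standard Borel space with measurable order. -/
theorem exists_coupling_trans {S : Type*} [Preorder S] [MeasurableSpace S]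
    [StandardBorelSpace S] [Nonempty S] (hle : MeasurableSet {z : S × S | z.1 ≤ z.2})
    (μ ν : Measure (S × S)) [IsProbabilityMeasure μ] [IsProbabilityMeasure ν]
    (h : μ.map Prod.snd = ν.map Prod.fst)
    (hμ : ∀ᵐ z ∂μ, z.1 ≤ z.2) (hν : ∀ᵐ z ∂ν, z.1 ≤ z.2) :
    ∃ m : Measure (S × S), IsProbabilityMeasure m ∧
      m.map Prod.fst = μ.map Prod.fst ∧ m.map Prod.snd = ν.map Prod.snd ∧
      ∀ᵐ z ∂m, z.1 ≤ z.2 := by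
  obtain ⟨m, hm, rfl, rfl⟩ := exists_glued_coupling μ ν h
  have hg : Measurable fun z : (S × S) × S => (z.1.2, z.2) := by fun_prop
  have hf : Measurable fun z : (S × S) × S => (z.1.1, z.2) := by fun_prop
  refine ⟨m.map fun z => (z.1.1, z.2), Measure.isProbabilityMeasure_map hf.aemeasurable, ?_, ?_, ?_⟩
  · rw [Measure.map_map measurable_fst hf, Measure.map_map measurable_fst measurable_fst]
    rfl
  · rw [Measure.map_map measurable_snd hf, Measure.map_map measurable_snd hg]
    rfl
  · rw [ae_map_iff hf.aemeasurable hle]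
    filter_upwards [ae_of_ae_map measurable_fst.aemeasurable hμ,
      ae_of_ae_map hg.aemeasurable hν] with z h₁ h₂
    exact le_trans h₁ h₂

/-- A coupling of measures concentrated on a set `S` is carried to `S × S` by any measurable
retraction onto `S`. -/
theorem ae_le_map_of_retraction {X : Type*} [Preorder X] [MeasurableSpace X] {S : Set X}
    {ρ : X → S} (hρ : Measurable ρ) (hρS : ∀ x ∈ S, (ρ x : X) = x)
    (hle : MeasurableSet {z : S × S | z.1 ≤ z.2}) {m : Measure (X × X)}
    (hm : ∀ᵐ z ∂m, z.1 ≤ z.2) (h₁ : ∀ᵐ x ∂m.map Prod.fst, x ∈ S)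
    (h₂ : ∀ᵐ x ∂m.map Prod.snd, x ∈ S) :
    ∀ᵐ z ∂m.map (Prod.map ρ ρ), z.1 ≤ z.2 := by
  rw [ae_map_iff (hρ.prodMap hρ).aemeasurable hle]
  filter_upwards [hm, ae_of_ae_map measurable_fst.aemeasurable h₁,
    ae_of_ae_map measurable_snd.aemeasurable h₂] with z hz hz₁ hz₂
  rw [← Subtype.coe_le_coe]
  simpa [hρS _ hz₁, hρS _ hz₂] using hz


/-- **Transitivity of the stochastic order.**
On an ordered metric space `X` (metric space with a partial order whose graph is
closed in `X × X`), define `p ⪯ q` for Radon probability measures to mean that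
there is a probability measure on `X × X` with marginals `p` and `q` supported on
`{(x,y) | x ≤ y}`.  Then `p ⪯ q` and `q ⪯ r` imply `p ⪯ r`. -/
theorem stochasticOrder_trans
    {X : Type*} [MetricSpace X] [PartialOrder X]
    [MeasurableSpace X] [BorelSpace X]
    (hclosed : IsClosed {z : X × X | z.1 ≤ z.2})
    (p q r : Measure X) [IsProbabilityMeasure p] [IsProbabilityMeasure q]
    [IsProbabilityMeasure r] [p.InnerRegular] [q.InnerRegular] [r.InnerRegular]
    (hpq : ∃ m : Measure (X × X), IsProbabilityMeasure m ∧
      m.map Prod.fst = p ∧ m.map Prod.snd = q ∧ m {z : X × X | z.1 ≤ z.2}ᶜ = 0)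
    (hqr : ∃ m : Measure (X × X), IsProbabilityMeasure m ∧
      m.map Prod.fst = q ∧ m.map Prod.snd = r ∧ m {z : X × X | z.1 ≤ z.2}ᶜ = 0) :
    ∃ m : Measure (X × X), IsProbabilityMeasure m ∧
      m.map Prod.fst = p ∧ m.map Prod.snd = r ∧ m {z : X × X | z.1 ≤ z.2}ᶜ = 0 := by
  obtain ⟨m₁, hm₁, rfl, hm₁q, hle₁⟩ := hpq
  obtain ⟨m₂, hm₂, hm₂q, rfl, hle₂⟩ := hqr
  obtain ⟨A, hA, hpA⟩ := exists_isSigmaCompact_measure_compl_eq_zero (m₁.map Prod.fst)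
  obtain ⟨B, hB, hqB⟩ := exists_isSigmaCompact_measure_compl_eq_zero q
  obtain ⟨C, hC, hrC⟩ := exists_isSigmaCompact_measure_compl_eq_zero (m₂.map Prod.snd)
  obtain ⟨S, hS, hpS, hqS, hrS⟩ : ∃ S : Set X, IsSigmaCompact S ∧
      (∀ᵐ x ∂m₁.map Prod.fst, x ∈ S) ∧ (∀ᵐ x ∂q, x ∈ S) ∧ ∀ᵐ x ∂m₂.map Prod.snd, x ∈ S := by
    refine ⟨A ∪ B ∪ C, (hA.union hB).union hC, ?_, ?_, ?_⟩
    · filter_upwards [mem_ae_iff.2 hpA] with x hx using Or.inl (Or.inl hx)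
    · filter_upwards [mem_ae_iff.2 hqB] with x hx using Or.inl (Or.inr hx)
    · filter_upwards [mem_ae_iff.2 hrC] with x hx using Or.inr hx
  have hSm : MeasurableSet S := hS.measurableSet
  have : SigmaCompactSpace S := isSigmaCompact_iff_sigmaCompactSpace.1 hS
  have : SecondCountableTopology S := EMetric.secondCountable_of_sigmaCompact S
  have : StandardBorelSpace S := standardBorelSpace_of_sigmaCompactSpace S
  obtain ⟨x₀, hx₀⟩ := hqS.exists
  have : Nonempty S := ⟨⟨x₀, hx₀⟩⟩
  classical
  obtain ⟨ρ, hρ, hρS⟩ : ∃ ρ : X → S, Measurable ρ ∧ ∀ x ∈ S, (ρ x : X) = x := by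
    refine ⟨fun x => if hx : x ∈ S then ⟨x, hx⟩ else ⟨x₀, hx₀⟩,
      Measurable.dite measurable_id measurable_const hSm, fun x hx => by simp [hx]⟩
  have hle : MeasurableSet {z : S × S | z.1 ≤ z.2} :=
    (hclosed.preimage (continuous_subtype_val.prodMap continuous_subtype_val)).measurableSet
  have hρρ : Measurable (Prod.map ρ ρ) := hρ.prodMap hρ
  have hfst (m : Measure (X × X)) :
      (m.map (Prod.map ρ ρ)).map Prod.fst = (m.map Prod.fst).map ρ := by
    rw [Measure.map_map measurable_fst hρρ, Measure.map_map hρ measurable_fst]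
    rfl
  have hsnd (m : Measure (X × X)) :
      (m.map (Prod.map ρ ρ)).map Prod.snd = (m.map Prod.snd).map ρ := by
    rw [Measure.map_map measurable_snd hρρ, Measure.map_map hρ measurable_snd]
    rfl
  have hback (p : Measure X) (hp : ∀ᵐ x ∂p, x ∈ S) : (p.map ρ).map Subtype.val = p := by
    rw [Measure.map_map measurable_subtype_coe hρ]
    conv_rhs => rw [← Measure.map_id (μ := p)]
    exact Measure.map_congr (hp.mono hρS)
  have : IsProbabilityMeasure (m₁.map (Prod.map ρ ρ)) :=
    Measure.isProbabilityMeasure_map hρρ.aemeasurable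
  have : IsProbabilityMeasure (m₂.map (Prod.map ρ ρ)) :=
    Measure.isProbabilityMeasure_map hρρ.aemeasurable
  obtain ⟨m, hm, hmp, hmr, hmle⟩ := exists_coupling_trans hle (m₁.map (Prod.map ρ ρ))
    (m₂.map (Prod.map ρ ρ)) (by rw [hfst, hsnd, hm₁q, hm₂q])
    (ae_le_map_of_retraction hρ hρS hle (ae_iff.2 hle₁) hpS (hm₁q ▸ hqS))
    (ae_le_map_of_retraction hρ hρS hle (ae_iff.2 hle₂) (hm₂q ▸ hqS) hrS)
  have hemb : MeasurableEmbedding (Prod.map Subtype.val Subtype.val : S × S → X × X) :=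
    (MeasurableEmbedding.subtype_coe hSm).prodMap (MeasurableEmbedding.subtype_coe hSm)
  refine ⟨m.map (Prod.map Subtype.val Subtype.val),
    Measure.isProbabilityMeasure_map hemb.measurable.aemeasurable, ?_, ?_, ?_⟩
  · rw [Measure.map_map measurable_fst hemb.measurable, ← hback _ hpS, ← hfst, ← hmp,
      Measure.map_map measurable_subtype_coe measurable_fst]
    rfl
  · rw [Measure.map_map measurable_snd hemb.measurable, ← hback _ hrS, ← hsnd, ← hmr,
      Measure.map_map measurable_subtype_coe measurable_snd]
    rfl
  · rw [hemb.map_apply]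
    exact ae_iff.1 hmle
end
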